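/- arXiv:2501.05276 — 6 statements merged into one kernel-verified Lean document; each statement's English description precedes it below -/
import Mathlib

section
/- Let (M, ⊵) be a target for a prefactor system (M_I, ⊵), and define a ∼_i b iff there exist a_i, b_i ∈ M_i with a ⊵ a_i, b ⊵ b_i and a_i ≍ b_i. Then (M, ∼_I) is an 𝔉-set: each ∼_i is a partial equivalence relation, the family is dense (I_a ∈ 𝔉(I) for all a ∈ M), and the family is approximating (for i ≤ i', a ∼_{i'} b together with a ∼_i a and b ∼_i b implies a ∼_i b). -/
/-- A prefactor system over a directed preorder `I`: a family of sets `A i`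
with relations `rel : A i' → A i → Prop` for `i ≤ i'`, reflexive at equal
stages, satisfying the (Factor) property: `a' ≍ a ↔ a' ⊵ a` for `i ≤ i'`. -/
structure PrefactorSystem (I : Type*) [Preorder I] where
  /-- the family of sets -/
  A : I → Type*
  /-- the predecessor relation `⊵` -/
  rel : ∀ ⦃i i' : I⦄, i ≤ i' → A i' → A i → Prop
  refl : ∀ (i : I) (h : i ≤ i) (a : A i), rel h a a
  /-- the (Factor) property, with consistency `≍` spelled out -/
  factor : ∀ ⦃i i' : I⦄ (h : i ≤ i') (a' : A i') (a : A i),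
    (∃ (k : I) (h1 : i' ≤ k) (h2 : i ≤ k) (c : A k), rel h1 c a' ∧ rel h2 c a) ↔ rel h a' a

/-- Consistency `a ≍ b` of two elements of a system. -/
def PrefactorSystem.Cons {I : Type*} [Preorder I] (S : PrefactorSystem I)
    {i j : I} (a : S.A i) (b : S.A j) : Prop :=
  ∃ (k : I) (h1 : i ≤ k) (h2 : j ≤ k) (c : S.A k), S.rel h1 c a ∧ S.rel h2 c b

/-- A target `(M, ⊵)` for a prefactor system. -/
structure Target {I : Type*} [Preorder I] (F : Set (Set I)) (S : PrefactorSystem I) where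
  /-- the carrier of the target -/
  M : Type*
  /-- the relation `a ⊵ a_i` between `M` and the stages -/
  R : ∀ i : I, M → S.A i → Prop
  /-- `I_a ∈ 𝔉(I)` for every `a ∈ M` -/
  dense : ∀ a : M, {i | ∃ x, R i a x} ∈ F
  /-- `a ⊵ a_{i'}` and `a ⊵ a_i` imply `a_{i'} ⊵ a_i` for `i ≤ i'` -/
  compat : ∀ ⦃i i' : I⦄ (h : i ≤ i') (a : M) (x' : S.A i') (x : S.A i),
    R i' a x' → R i a x → S.rel h x' x

/-- The induced family of relations `a ∼_i b` on a target. -/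
def Target.per {I : Type*} [Preorder I] {F : Set (Set I)} {S : PrefactorSystem I}
    (T : Target F S) (i : I) (a b : T.M) : Prop :=
  ∃ (x y : S.A i), T.R i a x ∧ T.R i b y ∧ S.Cons x y

namespace PrefactorSystem

variable {I : Type*} [Preorder I] (S : PrefactorSystem I)

theorem Cons.symm {S : PrefactorSystem I} {i j : I} {a : S.A i} {b : S.A j}
    (h : S.Cons a b) : S.Cons b a := by
  obtain ⟨k, h1, h2, c, ha, hb⟩ := h
  exact ⟨k, h2, h1, c, hb, ha⟩

theorem cons_iff_rel {i i' : I} (h : i ≤ i') (a' : S.A i') (a : S.A i) :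
    S.Cons a' a ↔ S.rel h a' a :=
  S.factor h a' a

theorem cons_refl {i : I} (a : S.A i) : S.Cons a a :=
  (S.cons_iff_rel le_rfl a a).2 (S.refl i le_rfl a)

/-- Consistency composes through a middle element whose stage bounds the outer stages. -/
theorem Cons.trans {S : PrefactorSystem I} {i j k : I} (hi : i ≤ j) (hk : k ≤ j)
    {a : S.A i} {b : S.A j} {c : S.A k} (hab : S.Cons a b) (hbc : S.Cons b c) : S.Cons a c :=
  ⟨j, hi, hk, b, (S.cons_iff_rel hi b a).1 hab.symm, (S.cons_iff_rel hk b c).1 hbc⟩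

end PrefactorSystem

theorem Target.cons_of_le {I : Type*} [Preorder I] {F : Set (Set I)} {S : PrefactorSystem I}
    (T : Target F S) {i i' : I} (h : i ≤ i') {a : T.M} {x' : S.A i'} {x : S.A i}
    (hx' : T.R i' a x') (hx : T.R i a x) : S.Cons x' x :=
  (S.cons_iff_rel h x' x).2 (T.compat h a x' x hx' hx)

/-- for a target `(M, ⊵)` of a prefactor system, the induced
relations `a ∼_i b` (defined via consistent approximations) form an 𝔉-set:
each `∼_i` is a partial equivalence relation, the family is dense, and the
family is approximating. -/
theorem stmt4 {I : Type*} [Preorder I] [Nonempty I] [IsDirected I (· ≤ ·)]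
    {F : Set (Set I)} (hcof : ∀ H ∈ F, ∀ i : I, ∃ j ∈ H, i ≤ j)
    {S : PrefactorSystem I} (T : Target F S) :
    (∀ (i : I) (a b : T.M), T.per i a b → T.per i b a) ∧
    (∀ (i : I) (a b c : T.M), T.per i a b → T.per i b c → T.per i a c) ∧
    (∀ a : T.M, {i | T.per i a a} ∈ F) ∧
    (∀ ⦃i i' : I⦄, i ≤ i' → ∀ a b : T.M,
      T.per i' a b → T.per i a a → T.per i b b → T.per i a b) := by
  refine ⟨?_, ?_, ?_, ?_⟩
  · rintro i a b ⟨x, y, hx, hy, hxy⟩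
    exact ⟨y, x, hy, hx, hxy.symm⟩
  · rintro i a b c ⟨x, y, hx, hy, hxy⟩ ⟨y', z, hy', hz, hyz⟩
    have hyy := T.cons_of_le le_rfl hy hy'
    exact ⟨x, z, hx, hz, hxy.trans le_rfl le_rfl (hyy.trans le_rfl le_rfl hyz)⟩
  · intro a
    have hset : {i | T.per i a a} = {i | ∃ x, T.R i a x} := by
      ext i
      exact ⟨fun ⟨x, _, hx, _⟩ => ⟨x, hx⟩, fun ⟨x, hx⟩ => ⟨x, x, hx, hx, S.cons_refl x⟩⟩
    rw [hset]
    exact T.dense a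
  · rintro i i' h a b ⟨x', y', hx', hy', hxy⟩ ⟨x, _, hx, _⟩ ⟨y, _, hy, _⟩
    have hxy' := (T.cons_of_le h hx' hx).symm.trans h le_rfl hxy
    exact ⟨x, y, hx, hy, hxy'.trans h h (T.cons_of_le h hy' hy)⟩
end

section
/- Let (M, ⊵) be a target for a prefactor system (M_I, ⊵), with a ∼_i b defined by: there exist a_i, b_i ∈ M_i with a ⊵ a_i, b ⊵ b_i and a_i ≍ b_i. Assume 𝔉(I) is closed under finite intersections. Then the following are equivalent: (i) for all a, b ∈ M, if a ∼_i b holds for a cofinal set of indices i ∈ I, then a = b; (ii) for all a, b ∈ M, if a ∼_i b holds for all i ∈ I_a ∩ I_b, then a = b (where I_a := {i ∈ I : ∃ a_i ∈ M_i, a ⊵ a_i}). -/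
theorem PrefactorSystem.Cons.symm_s5 {I : Type*} [Preorder I] {S : PrefactorSystem I}
    {i j : I} {a : S.A i} {b : S.A j} (h : S.Cons a b) : S.Cons b a := by
  obtain ⟨k, hi, hj, c, ha, hb⟩ := h
  exact ⟨k, hj, hi, c, hb, ha⟩

/-- Consistency of two elements of the same stage descends to their predecessors. -/
theorem PrefactorSystem.Cons.of_rel {I : Type*} [Preorder I] {S : PrefactorSystem I}
    {i j : I} {x' y' : S.A j} {x y : S.A i} (h : S.Cons x' y') (hij : i ≤ j)
    (hx : S.rel hij x' x) (hy : S.rel hij y' y) : S.Cons x y := by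
  have hyx : S.rel le_rfl y' x' := (S.factor le_rfl y' x').1 h.symm_s5
  exact ⟨j, hij, hij, x', hx, (S.factor hij x' y).1 ⟨j, le_rfl, hij, y', hyx, hy⟩⟩

/-- for a target `(M, ⊵)` of a prefactor system, assuming `𝔉(I)`
is closed under finite intersections, the following are equivalent:
(i) whenever `a ∼_i b` holds for a cofinal set of indices `i`, then `a = b`;
(ii) whenever `a ∼_i b` holds for all `i ∈ I_a ∩ I_b`, then `a = b`. -/
theorem stmt5 {I : Type*} [Preorder I] [Nonempty I] [IsDirected I (· ≤ ·)]
    {F : Set (Set I)} (hcof : ∀ H ∈ F, ∀ i : I, ∃ j ∈ H, i ≤ j)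
    (hinter : ∀ H1 ∈ F, ∀ H2 ∈ F, H1 ∩ H2 ∈ F)
    {S : PrefactorSystem I} (T : Target F S) :
    (∀ a b : T.M, (∀ i : I, ∃ j, i ≤ j ∧ T.per j a b) → a = b) ↔
    (∀ a b : T.M,
      (∀ i : I, (∃ x, T.R i a x) → (∃ y, T.R i b y) → T.per i a b) → a = b) := by
  constructor
  · intro hcofinal a b hab
    refine hcofinal a b fun i ↦ ?_
    obtain ⟨j, ⟨ha, hb⟩, hij⟩ := hcof _ (hinter _ (T.dense a) _ (T.dense b)) i
    exact ⟨j, hij, hab j ha hb⟩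
  · intro hall a b hab
    refine hall a b fun i ⟨x, hx⟩ ⟨y, hy⟩ ↦ ?_
    obtain ⟨j, hij, x', y', hx', hy', hcons⟩ := hab i
    exact ⟨x, y, hx, hy, hcons.of_rel hij (T.compat hij a x' x hx' hx)
      (T.compat hij b y' y hy' hy)⟩
end

section
/- Let (M, ⊵, Emb) be a target for a prefactor system with embeddings (M_I, ⊵, emb). Then for all i ∈ I and all a_i, b_i ∈ M_i: a_i ≍ b_i if and only if Emb_i(a_i) = Emb_i(b_i). -/
/-- A prefactor system with (coherent) embeddings. -/
structure PrefactorSystemEmb (I : Type*) [Preorder I] extends PrefactorSystem I where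
  /-- the embeddings `emb_{i,i'} : A i → A i'` for `i ≤ i'` -/
  emb : ∀ ⦃i i' : I⦄, i ≤ i' → A i → A i'
  /-- the embeddings preserve consistency -/
  emb_pres : ∀ ⦃i i' : I⦄ (h : i ≤ i') (a b : A i),
    toPrefactorSystem.Cons a b → toPrefactorSystem.Cons (emb h a) (emb h b)
  /-- `emb_{i,i}(a) ≍ a` -/
  emb_self : ∀ (i : I) (h : i ≤ i) (a : A i), toPrefactorSystem.Cons (emb h a) a
  /-- `emb_{i',i''}(emb_{i,i'}(a)) ≍ emb_{i,i''}(a)` -/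
  emb_comp : ∀ ⦃i i' i'' : I⦄ (h1 : i ≤ i') (h2 : i' ≤ i'') (a : A i),
    toPrefactorSystem.Cons (emb h2 (emb h1 a)) (emb (h1.trans h2) a)
  /-- the coherence property (Emb) -/
  emb_rel : ∀ ⦃i i' i'' : I⦄ (h : i ≤ i') (h2 : i' ≤ i'') (a' : A i') (a : A i),
    rel h a' a → rel (h.trans h2) (emb h2 a') a

/-- A target `(M, ⊵, Emb)` for a prefactor system with embeddings. -/
structure TargetEmb {I : Type*} [Preorder I] (F : Set (Set I)) (S : PrefactorSystemEmb I) where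
  /-- the carrier of the target -/
  M : Type*
  /-- the relation `a ⊵ a_i` between `M` and the stages -/
  R : ∀ i : I, M → S.A i → Prop
  /-- `I_a ∈ 𝔉(I)` for every `a ∈ M` -/
  dense : ∀ a : M, {i | ∃ x, R i a x} ∈ F
  /-- `a ⊵ a_{i'}` and `a ⊵ a_i` imply `a_{i'} ⊵ a_i` for `i ≤ i'` -/
  compat : ∀ ⦃i i' : I⦄ (h : i ≤ i') (a : M) (x' : S.A i') (x : S.A i),
    R i' a x' → R i a x → S.rel h x' x
  /-- the maps `Emb_i : A i → M` -/
  Emb : ∀ i : I, S.A i → M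
  /-- `Emb_i` preserves consistency (consistency on the target being equality) -/
  Emb_pres : ∀ (i : I) (a b : S.A i), S.toPrefactorSystem.Cons a b → Emb i a = Emb i b
  /-- `Emb_{i'}(emb_{i,i'}(a)) = Emb_i(a)` -/
  Emb_comm : ∀ ⦃i i' : I⦄ (h : i ≤ i') (a : S.A i), Emb i' (S.emb h a) = Emb i a
  /-- `a' ⊵ a` implies `Emb_{i'}(a') ⊵ a` -/
  Emb_rel : ∀ ⦃i i' : I⦄ (h : i ≤ i') (a' : S.A i') (a : S.A i),
    S.rel h a' a → R i (Emb i' a') a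

/-- The induced family of relations `a ∼_i b` on a target. -/
def TargetEmb.per {I : Type*} [Preorder I] {F : Set (Set I)} {S : PrefactorSystemEmb I}
    (T : TargetEmb F S) (i : I) (a b : T.M) : Prop :=
  ∃ (x y : S.A i), T.R i a x ∧ T.R i b y ∧ S.toPrefactorSystem.Cons x y

/-- The induced point maps `pt_i(a) := Emb_i(a_i)` for some `a_i` with `a ⊵ a_i`
(junk value outside the domain `[i]`). -/
noncomputable def TargetEmb.pt {I : Type*} [Preorder I] {F : Set (Set I)}
    {S : PrefactorSystemEmb I} (T : TargetEmb F S) (i : I) (a : T.M) : T.M :=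
  letI := Classical.propDecidable (∃ x, T.R i a x)
  if h : ∃ x, T.R i a x then T.Emb i h.choose else a

/-- for a target `(M, ⊵, Emb)` of a prefactor system with
embeddings, for all `i` and all `a, b ∈ A i`: `a ≍ b ↔ Emb_i(a) = Emb_i(b)`. -/
theorem stmt6 {I : Type*} [Preorder I] [Nonempty I] [IsDirected I (· ≤ ·)]
    {F : Set (Set I)} (hcof : ∀ H ∈ F, ∀ i : I, ∃ j ∈ H, i ≤ j)
    {S : PrefactorSystemEmb I} (T : TargetEmb F S) (i : I) (a b : S.A i) :
    S.toPrefactorSystem.Cons a b ↔ T.Emb i a = T.Emb i b := by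
  refine ⟨T.Emb_pres i a b, fun h => ?_⟩
  have ha := T.Emb_rel le_rfl a a (S.refl i le_rfl a)
  have hb := T.Emb_rel le_rfl b b (S.refl i le_rfl b)
  rw [← h] at hb
  exact (S.factor le_rfl a b).mpr (T.compat le_rfl _ a b ha hb)
end

section
/- Let M be a set with a family of partial equivalence relations ∼_i (i ∈ I) and surjective maps Pt_i : M → P_i with P_i ⊆ M, and let pt_i be the restriction of Pt_i to [i] := {a : a ∼_i a}. Suppose for all i ≤ i': (1) for every a ∈ M the set {i : a ∼_i a} belongs to 𝔉(I); (2) P_i ⊆ P_{i'}; (3) a ∼_i b implies a ∼_i Pt_i(a) and Pt_i(a) = Pt_i(b); (4) Pt_i = Pt_i ∘ Pt_{i'}; (5) a ∈ [i] implies Pt_{i'}(a) ∈ [i]. Then the family ∼_I is approximating (for i ≤ i', a ∼_{i'} b together with a, b ∈ [i] implies a ∼_i b), and hence (M, ∼_I, Pt_I) is a PER-set. -/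
/-- let `M` carry a family of partial equivalence relations
`per i` and surjective total maps `Pt_i : M → P_i` (with `pt_i` the
restriction of `Pt_i` to `[i] = {a | per i a a}`) such that for `i ≤ i'`:
(1) density holds; (2) `P_i ⊆ P_{i'}`; (3) `a ∼_i b` implies
`a ∼_i Pt_i(a)` and `Pt_i(a) = Pt_i(b)`; (4) `Pt_i = Pt_i ∘ Pt_{i'}`;
(5) `a ∈ [i]` implies `Pt_{i'}(a) ∈ [i]`.  Then the family is approximating
(and hence `(M, ∼, Pt)` is a PER-set). -/
theorem stmt9 {I M : Type*} [Preorder I] [Nonempty I] [IsDirected I (· ≤ ·)]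
    {F : Set (Set I)} (hcof : ∀ H ∈ F, ∀ i : I, ∃ j ∈ H, i ≤ j)
    (per : I → M → M → Prop) (P : I → Set M) (Pt : I → M → M)
    (symm : ∀ i (a b : M), per i a b → per i b a)
    (trans : ∀ i (a b c : M), per i a b → per i b c → per i a c)
    (Pt_mem : ∀ i (a : M), Pt i a ∈ P i)
    (Pt_surj : ∀ i : I, ∀ p ∈ P i, ∃ a : M, Pt i a = p)
    (dense : ∀ a : M, {i | per i a a} ∈ F)
    (P_mono : ∀ ⦃i i' : I⦄, i ≤ i' → P i ⊆ P i')
    (pt_eq : ∀ i (a b : M), per i a b → per i a (Pt i a) ∧ Pt i a = Pt i b)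
    (Pt_comp : ∀ ⦃i i' : I⦄, i ≤ i' → ∀ a : M, Pt i (Pt i' a) = Pt i a)
    (Pt_dom : ∀ ⦃i i' : I⦄, i ≤ i' → ∀ a : M, per i a a → per i (Pt i' a) (Pt i' a)) :
    ∀ ⦃i i' : I⦄, i ≤ i' → ∀ a b : M,
      per i' a b → per i a a → per i b b → per i a b := by
  intro i i' hii a b hab ha hb
  have hPt : Pt i a = Pt i b := by
    rw [← Pt_comp hii a, ← Pt_comp hii b, (pt_eq i' a b hab).2]
  exact trans i a (Pt i a) b (pt_eq i a a ha).1 (hPt ▸ symm i b (Pt i b) (pt_eq i b b hb).1)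
end

section
/- Let (M, ∼_I, Pt_I) and (N, ∼_J, Pt_J) be PER-sets. For f, g : M → N define f ⊥_{i→j} g iff f(a) ⊥_j g(a) for all a ∈ P_i; and f ∈ P_{i→j} iff for all a, b ∈ M, a ⊥_i b implies f(a) = f(b) ∈ P_j. Then for every function f : M → N and all i ∈ I, j ∈ J: (i) Pt_j ∘ f ∘ Pt_i ∈ P_{i→j}; (ii) (Pt_j ∘ f ∘ Pt_i) ⊥_{i→j} f; (iii) if f ⊥_{i→j} g then Pt_j ∘ f ∘ Pt_i = Pt_j ∘ g ∘ Pt_i. Hence Pt_{i→j}(f) := Pt_j ∘ f ∘ Pt_i defines a map into P_{i→j} constant on ⊥_{i→j}-classes. -/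
/-- A PER-set: a set `M` with a dense, approximating family of partial
equivalence relations `per i`, subsets of points `P i ⊆ M`, and total maps
`Pt i : M → P i` extending the surjective point maps `pt_i : [i] → P i`
(where `[i] = {a | per i a a}`), with `Pt i = Pt i ∘ Pt i'` and
`a ∈ [i] → Pt i' a ∈ [i]` for `i ≤ i'`. -/
structure PERSet (I : Type*) [Preorder I] (F : Set (Set I)) (M : Type*) where
  /-- the family of partial equivalence relations -/
  per : I → M → M → Prop
  symm : ∀ i (a b : M), per i a b → per i b a
  trans : ∀ i (a b c : M), per i a b → per i b c → per i a c
  /-- density: `I_a = {i | a ∼_i a} ∈ 𝔉(I)` -/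
  dense : ∀ a : M, {i | per i a a} ∈ F
  /-- approximating -/
  approx : ∀ ⦃i i' : I⦄, i ≤ i' → ∀ a b : M, per i' a b → per i a a → per i b b → per i a b
  /-- the sets of points -/
  P : I → Set M
  /-- the total point maps `Pt_i : M → P_i` -/
  Pt : I → M → M
  Pt_mem : ∀ i (a : M), Pt i a ∈ P i
  /-- `pt_i = Pt_i|[i] : [i] → P i` is surjective -/
  pt_surj : ∀ i : I, ∀ p ∈ P i, ∃ a : M, per i a a ∧ Pt i a = p
  /-- `P i ⊆ P i'` for `i ≤ i'` -/
  P_mono : ∀ ⦃i i' : I⦄, i ≤ i' → P i ⊆ P i'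
  /-- `a ∼_i b` implies `a ∼_i pt_i(a)` and `pt_i(a) = pt_i(b)` -/
  pt_eq : ∀ i (a b : M), per i a b → per i a (Pt i a) ∧ Pt i a = Pt i b
  /-- `Pt_i = Pt_i ∘ Pt_{i'}` for `i ≤ i'` -/
  Pt_comp : ∀ ⦃i i' : I⦄, i ≤ i' → ∀ a : M, Pt i (Pt i' a) = Pt i a
  /-- `a ∈ [i]` implies `Pt_{i'}(a) ∈ [i]` for `i ≤ i'` -/
  Pt_dom : ∀ ⦃i i' : I⦄, i ≤ i' → ∀ a : M, per i a a → per i (Pt i' a) (Pt i' a)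

/-- The relation `f ∼_{i→j} g` on functions between two PER-sets
(a logical relation). -/
def perFun {I J M N : Type*} [Preorder I] [Preorder J]
    {FI : Set (Set I)} {FJ : Set (Set J)}
    (SM : PERSet I FI M) (SN : PERSet J FJ N) (i : I) (j : J) (f g : M → N) : Prop :=
  ∀ a b : M, SM.per i a b → SN.per j (f a) (g b)

/-- The relation `f ⊥_{i→j} g` on functions between two PER-sets:
`f(a) ⊥_j g(a)` for all points `a ∈ P_i`. -/
def perpFun {I J M N : Type*} [Preorder I] [Preorder J]
    {FI : Set (Set I)} {FJ : Set (Set J)}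
    (SM : PERSet I FI M) (SN : PERSet J FJ N) (i : I) (j : J) (f g : M → N) : Prop :=
  ∀ a ∈ SM.P i, SN.Pt j (f a) = SN.Pt j (g a)

/-- The points `P_{i→j}` of the function space: step functions with values in
`P_j`, constant on the `⊥_i`-classes. -/
def PtsFun {I J M N : Type*} [Preorder I] [Preorder J]
    {FI : Set (Set I)} {FJ : Set (Set J)}
    (SM : PERSet I FI M) (SN : PERSet J FJ N) (i : I) (j : J) : Set (M → N) :=
  {f | ∀ a b : M, SM.Pt i a = SM.Pt i b → f a = f b ∧ f a ∈ SN.P j}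

/-- The total point maps on the function space: `Pt_{i→j}(f) := Pt_j ∘ f ∘ Pt_i`. -/
def PtFun {I J M N : Type*} [Preorder I] [Preorder J]
    {FI : Set (Set I)} {FJ : Set (Set J)}
    (SM : PERSet I FI M) (SN : PERSet J FJ N) (i : I) (j : J) (f : M → N) : M → N :=
  fun a => SN.Pt j (f (SM.Pt i a))

/-- The total point map `Pt i` fixes every point of `P i`. -/
theorem PERSet.Pt_of_mem {I M : Type*} [Preorder I] {F : Set (Set I)} (S : PERSet I F M)
    {i : I} {p : M} (hp : p ∈ S.P i) : S.Pt i p = p := by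
  obtain ⟨a, -, rfl⟩ := S.pt_surj i p hp
  exact S.Pt_comp le_rfl a

/-- for PER-sets `M`, `N`, every function `f : M → N` and all
`i ∈ I`, `j ∈ J`: (i) `Pt_j ∘ f ∘ Pt_i ∈ P_{i→j}`;
(ii) `(Pt_j ∘ f ∘ Pt_i) ⊥_{i→j} f`; (iii) if `f ⊥_{i→j} g` then
`Pt_j ∘ f ∘ Pt_i = Pt_j ∘ g ∘ Pt_i`.  Hence `Pt_{i→j}` defines a map into
`P_{i→j}` constant on `⊥_{i→j}`-classes. -/
theorem stmt16 {I J M N : Type*} [Preorder I] [Preorder J]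
    [Nonempty I] [IsDirected I (· ≤ ·)] [Nonempty J] [IsDirected J (· ≤ ·)]
    {FI : Set (Set I)} {FJ : Set (Set J)}
    (hcofI : ∀ H ∈ FI, ∀ i : I, ∃ i' ∈ H, i ≤ i')
    (hcofJ : ∀ H ∈ FJ, ∀ j : J, ∃ j' ∈ H, j ≤ j')
    (SM : PERSet I FI M) (SN : PERSet J FJ N) (f : M → N) (i : I) (j : J) :
    PtFun SM SN i j f ∈ PtsFun SM SN i j ∧
    perpFun SM SN i j (PtFun SM SN i j f) f ∧
    (∀ g : M → N, perpFun SM SN i j f g → PtFun SM SN i j f = PtFun SM SN i j g) := by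
  refine ⟨fun a b h => ⟨?_, SN.Pt_mem j _⟩, fun a ha => ?_, fun g h => ?_⟩
  · simp only [PtFun, h]
  · simp only [PtFun, SN.Pt_comp le_rfl, SM.Pt_of_mem ha]
  · exact funext fun a => h _ (SM.Pt_mem i a)
end

section
/- Let (M, ∼_I, Pt_I) and (N, ∼_J, Pt_J) be PER-sets. For f, g : M → N define f ∼_{i→j} g iff for all a, b ∈ M, a ∼_i b implies f(a) ∼_j g(b); f ∈ P_{i→j} iff a ⊥_i b implies f(a) = f(b) ∈ P_j for all a, b ∈ M; and Pt_{i→j}(f) := Pt_j ∘ f ∘ Pt_i. Then for all (i, j) ≤ (i', j') in I × J (product order): (i) P_{i→j} ⊆ P_{i'→j'}; (ii) if f ∼_{i→j} g then f ∼_{i→j} Pt_{i→j}(f) and Pt_{i→j}(f) = Pt_{i→j}(g); (iii) Pt_{i→j}(Pt_{i'→j'}(f)) = Pt_{i→j}(f); (iv) if f ∼_{i→j} f then Pt_{i'→j'}(f) ∼_{i→j} Pt_{i'→j'}(f); in fact a ∼_i b implies Pt_{i'→j'}(f)(a) ∼_j Pt_{i'→j'}(f)(b). -/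
namespace PERSet

variable {I M : Type*} [Preorder I] {F : Set (Set I)} (S : PERSet I F M) {i i' : I} {a b : M}

theorem per_refl_left (h : S.per i a b) : S.per i a a :=
  S.trans i a b a h (S.symm i a b h)

theorem per_refl_right (h : S.per i a b) : S.per i b b :=
  S.per_refl_left (S.symm i a b h)

theorem per_Pt_right (h : S.per i a b) : S.per i a (S.Pt i b) :=
  S.trans i a b _ h (S.pt_eq i b b (S.per_refl_right h)).1

theorem per_Pt_self (i : I) (a : M) : S.per i (S.Pt i a) (S.Pt i a) := by
  obtain ⟨b, hb, hba⟩ := S.pt_surj i _ (S.Pt_mem i a)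
  rw [← hba]
  exact S.per_refl_right (S.pt_eq i b b hb).1

theorem Pt_of_mem_P (h : a ∈ S.P i) : S.Pt i a = a := by
  obtain ⟨b, -, rfl⟩ := S.pt_surj i a h
  exact S.Pt_comp le_rfl b

theorem Pt_Pt_of_le (hi : i ≤ i') (a : M) : S.Pt i' (S.Pt i a) = S.Pt i a :=
  S.Pt_of_mem_P (S.P_mono hi (S.Pt_mem i a))

theorem Pt_eq_of_le (hi : i ≤ i') (h : S.Pt i' a = S.Pt i' b) : S.Pt i a = S.Pt i b := by
  rw [← S.Pt_comp hi a, h, S.Pt_comp hi b]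

theorem per_Pt_Pt (hi : i ≤ i') (h : S.per i a b) : S.per i (S.Pt i' a) (S.Pt i' b) := by
  have per_Pt : ∀ c, S.per i c c → S.per i (S.Pt i' c) (S.Pt i c) := fun c hc => by
    simpa only [S.Pt_comp hi] using (S.pt_eq i _ _ (S.Pt_dom hi c hc)).1
  have hab := per_Pt a (S.per_refl_left h)
  rw [(S.pt_eq i a b h).2] at hab
  exact S.trans i _ _ _ hab (S.symm i _ _ (per_Pt b (S.per_refl_right h)))

end PERSet

theorem perFun_refl_left {I J M N : Type*} [Preorder I] [Preorder J]
    {FI : Set (Set I)} {FJ : Set (Set J)} {SM : PERSet I FI M} {SN : PERSet J FJ N}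
    {i : I} {j : J} {f g : M → N} (h : perFun SM SN i j f g) : perFun SM SN i j f f :=
  fun a b hab =>
    SN.trans j _ _ _ (h a b hab) (SN.symm j _ _ (h b b (SM.per_refl_right hab)))

/-- for PER-sets `M`, `N` and `(i,j) ≤ (i',j')` in the product
order: (i) `P_{i→j} ⊆ P_{i'→j'}`; (ii) if `f ∼_{i→j} g` then
`f ∼_{i→j} Pt_{i→j}(f)` and `Pt_{i→j}(f) = Pt_{i→j}(g)`;
(iii) `Pt_{i→j}(Pt_{i'→j'}(f)) = Pt_{i→j}(f)`; (iv) if `f ∼_{i→j} f` then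
`Pt_{i'→j'}(f) ∼_{i→j} Pt_{i'→j'}(f)`; in fact `a ∼_i b` implies
`Pt_{i'→j'}(f)(a) ∼_j Pt_{i'→j'}(f)(b)`. -/
theorem stmt17 {I J M N : Type*} [Preorder I] [Preorder J]
    [Nonempty I] [IsDirected I (· ≤ ·)] [Nonempty J] [IsDirected J (· ≤ ·)]
    {FI : Set (Set I)} {FJ : Set (Set J)}
    (hcofI : ∀ H ∈ FI, ∀ i : I, ∃ i' ∈ H, i ≤ i')
    (hcofJ : ∀ H ∈ FJ, ∀ j : J, ∃ j' ∈ H, j ≤ j')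
    (SM : PERSet I FI M) (SN : PERSet J FJ N)
    {i i' : I} {j j' : J} (hi : i ≤ i') (hj : j ≤ j') :
    PtsFun SM SN i j ⊆ PtsFun SM SN i' j' ∧
    (∀ f g : M → N, perFun SM SN i j f g →
      perFun SM SN i j f (PtFun SM SN i j f) ∧ PtFun SM SN i j f = PtFun SM SN i j g) ∧
    (∀ f : M → N, PtFun SM SN i j (PtFun SM SN i' j' f) = PtFun SM SN i j f) ∧
    (∀ f : M → N, perFun SM SN i j f f →
      ∀ a b : M, SM.per i a b →
        SN.per j (PtFun SM SN i' j' f a) (PtFun SM SN i' j' f b)) := by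
  refine ⟨fun f hf a b hab => ?_, fun f g hfg => ⟨fun a b hab => ?_, ?_⟩, fun f => ?_,
    fun f hf a b hab => ?_⟩
  · exact (hf a b (SM.Pt_eq_of_le hi hab)).imp_right (SN.P_mono hj ·)
  · exact SN.per_Pt_right (perFun_refl_left hfg a _ (SM.per_Pt_right hab))
  · funext a
    exact (SN.pt_eq j _ _ (hfg _ _ (SM.per_Pt_self i a))).2
  · funext a
    simp only [PtFun, SN.Pt_comp hj, SM.Pt_Pt_of_le hi]
  · exact SN.per_Pt_Pt hj (hf _ _ (SM.per_Pt_Pt hi hab))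
end
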